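/- Define U(p,s) = 4^p (2π·15^{1/2})^{-s/2} / (3s/2 - p) + 2^{3p/2-1} s^{-p/2} ( Γ(p/2) - Γ(p/2+2)/(6s) + Γ(p/2+4)/(72 s²) ), D(p) = Γ(3-p) / ( Γ(2 - p/2)² Γ(3 - p/2) ), and G̃(p,s) = s^{-p/2} 2^{3p/2-1} Γ(p/2) D(p). Then for all 2 < p < 3 and all s ≥ 8/3, U(p,s) < G̃(p,s). -/

import Mathlib

open Real

/-- The upper bound `U(p,s)` for `F(p,s) = ∫_0^∞ |𝔧₁(t)|^s t^{p-1} dt`. -/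
noncomputable def Ufun (p s : ℝ) : ℝ :=
  4 ^ p * (2 * Real.pi * Real.sqrt 15) ^ (-s / 2) / (3 * s / 2 - p) +
    2 ^ (3 * p / 2 - 1) * s ^ (-p / 2) *
      (Real.Gamma (p / 2) - Real.Gamma (p / 2 + 2) / (6 * s) +
        Real.Gamma (p / 2 + 4) / (72 * s ^ 2))

/-- `D(p) = Γ(3-p) / (Γ(2-p/2)² Γ(3-p/2))`. -/
noncomputable def Dfun (p : ℝ) : ℝ :=
  Real.Gamma (3 - p) / (Real.Gamma (2 - p / 2) ^ 2 * Real.Gamma (3 - p / 2))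

/-- `G̃(p,s) = s^{-p/2} 2^{3p/2-1} Γ(p/2) D(p)`. -/
noncomputable def Gtilde (p s : ℝ) : ℝ :=
  s ^ (-p / 2) * 2 ^ (3 * p / 2 - 1) * Real.Gamma (p / 2) * Dfun p

/-- Midpoint log-convexity of the Gamma function. -/
lemma Gamma_midpoint_sq_le {a b : ℝ} (ha : 0 < a) (hb : 0 < b) :
    Gamma ((a + b) / 2) ^ 2 ≤ Gamma a * Gamma b := by
  have h := Gamma_mul_add_mul_le_rpow_Gamma_mul_rpow_Gamma ha hb
    (a := 1 / 2) (b := 1 / 2) (by norm_num) (by norm_num) (by norm_num)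
  rw [show 1 / 2 * a + 1 / 2 * b = (a + b) / 2 by ring, ← sqrt_eq_rpow, ← sqrt_eq_rpow] at h
  calc Gamma ((a + b) / 2) ^ 2 ≤ (√(Gamma a) * √(Gamma b)) ^ 2 :=
        pow_le_pow_left₀ (Gamma_pos_of_pos (by positivity)).le h 2
    _ = Gamma a * Gamma b := by
        rw [mul_pow, sq_sqrt (Gamma_pos_of_pos ha).le, sq_sqrt (Gamma_pos_of_pos hb).le]

lemma Gamma_two_sub_le {x : ℝ} (h0 : 0 ≤ x) (h1 : x ≤ 1 / 2) :
    Gamma (2 - x) ≤ 1 - 0.227 * x := by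
  have h := convexOn_Gamma.2 (show (2 : ℝ) ∈ Set.Ioi 0 by norm_num)
    (show (3 / 2 : ℝ) ∈ Set.Ioi 0 by norm_num)
    (show 0 ≤ 1 - 2 * x by linarith) (show 0 ≤ 2 * x by linarith) (by ring)
  have h32 : Gamma (3 / 2) = √π / 2 := by
    rw [show (3 / 2 : ℝ) = 1 / 2 + 1 by norm_num, Gamma_add_one (by norm_num), Gamma_one_half_eq]
    ring
  have hpi : √π ≤ 1.773 := by
    rw [sqrt_le_left (by norm_num)]
    linarith [pi_lt_d4]
  simp only [smul_eq_mul, h32, Gamma_two] at h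
  rw [show (1 - 2 * x) * 2 + 2 * x * (3 / 2) = 2 - x by ring] at h
  nlinarith

lemma inv_Gamma_one_add_le {x : ℝ} (h0 : 0 ≤ x) (h1 : x < 1 / 2) :
    1 / Gamma (1 + x) ≤ 1 / (1 - x) := by
  have h := Gamma_midpoint_sq_le (show 0 < 1 + x by linarith) (show 0 < 1 - x by linarith)
  rw [show (1 + x + (1 - x)) / 2 = 1 by ring, Gamma_one] at h
  have h2 := Gamma_add_one (show 1 - x ≠ 0 by linarith)
  rw [show 1 - x + 1 = 2 - x by ring] at h2
  have h3 := Gamma_two_sub_le h0 h1.le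
  have hpos : 0 < Gamma (1 + x) := Gamma_pos_of_pos (by linarith)
  refine one_div_le_one_div_of_le (by linarith) ?_
  nlinarith

lemma Dfun_two_add_lower {x : ℝ} (h0 : 0 ≤ x) (h1 : x < 1 / 2) :
    1 + x ^ 2 / (1 - 2 * x) + 0.227 * x ≤ Dfun (2 + 2 * x) := by
  have hx2 : 0 < 1 - 2 * x := by linarith
  have hx1 : 0 < 1 - x := by linarith
  have hg : 0 < Gamma (2 - x) := Gamma_pos_of_pos (by linarith)
  have hle := Gamma_two_sub_le h0 h1.le
  have hmid := Gamma_midpoint_sq_le (show 0 < 2 - 2 * x by linarith) (show (0 : ℝ) < 2 by norm_num)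
  rw [show (2 - 2 * x + 2) / 2 = 2 - x by ring, Gamma_two, mul_one] at hmid
  have e1 : Gamma (1 - x) = Gamma (2 - x) / (1 - x) := by
    rw [show 2 - x = 1 - x + 1 by ring, Gamma_add_one hx1.ne']
    field_simp
  have e2 : Gamma (1 - 2 * x) = Gamma (2 - 2 * x) / (1 - 2 * x) := by
    rw [show 2 - 2 * x = 1 - 2 * x + 1 by ring, Gamma_add_one hx2.ne']
    field_simp
  have hD : Dfun (2 + 2 * x) =
      (1 - x) ^ 2 / (1 - 2 * x) * (Gamma (2 - 2 * x) / Gamma (2 - x) ^ 3) := by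
    rw [Dfun, show 3 - (2 + 2 * x) = 1 - 2 * x by ring,
      show 2 - (2 + 2 * x) / 2 = 1 - x by ring, show 3 - (2 + 2 * x) / 2 = 2 - x by ring, e1, e2]
    field_simp
  have hinv : 1 + 0.227 * x ≤ Gamma (2 - 2 * x) / Gamma (2 - x) ^ 3 := by
    rw [le_div_iff₀ (by positivity)]
    calc (1 + 0.227 * x) * Gamma (2 - x) ^ 3
        = ((1 + 0.227 * x) * Gamma (2 - x)) * Gamma (2 - x) ^ 2 := by ring
      _ ≤ 1 * Gamma (2 - x) ^ 2 := by gcongr; nlinarith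
      _ ≤ _ := by rw [one_mul]; exact hmid
  have hsplit : (1 - x) ^ 2 / (1 - 2 * x) = 1 + x ^ 2 / (1 - 2 * x) := by
    rw [← sub_eq_iff_eq_add, ← sub_div, div_eq_one_iff_eq hx2.ne']
    ring
  rw [hD, hsplit]
  have : 0 ≤ x ^ 2 / (1 - 2 * x) := by positivity
  nlinarith

lemma two_mul_pi_mul_sqrt_fifteen_pow_four : (2 * π * √15) ^ 4 = 3600 * π ^ 4 := by
  rw [mul_pow, show √15 ^ 4 = (√15 ^ 2) ^ 2 by ring, sq_sqrt (by norm_num)]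
  ring

lemma two_mul_pi_mul_sqrt_fifteen_gt : 20 < 2 * π * √15 := by
  have h : (3.8 : ℝ) < √15 := by
    rw [lt_sqrt (by norm_num)]
    norm_num
  nlinarith [pi_gt_d4]

lemma mul_rpow_neg_four_thirds_le : 16 / 3 * (2 * π * √15) ^ (-(4 / 3) : ℝ) ≤ 0.0757 := by
  have hC : 0 < 2 * π * √15 := by positivity
  refine le_of_pow_le_pow_left₀ (n := 3) (by norm_num) (by norm_num) ?_
  have h : ((2 * π * √15) ^ (-(4 / 3) : ℝ)) ^ 3 = (3600 * π ^ 4)⁻¹ := by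
    rw [← rpow_natCast, ← rpow_mul hC.le, ← two_mul_pi_mul_sqrt_fifteen_pow_four,
      show (-(4 / 3) : ℝ) * (3 : ℕ) = -(4 : ℕ) by norm_num, rpow_neg hC.le, rpow_natCast]
  rw [mul_pow, h]
  have hpi : (3.1415 : ℝ) ^ 4 ≤ π ^ 4 := pow_le_pow_left₀ (by norm_num) pi_gt_d4.le 4
  rw [← div_eq_mul_inv, div_le_iff₀ (by positivity)]
  norm_num at hpi ⊢
  linarith

lemma sixteen_thirds_rpow_le {x : ℝ} (h0 : 0 ≤ x) (h1 : x ≤ 1 / 2) :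
    (16 / 3 : ℝ) ^ x ≤ 1 + 2.62 * x := by
  have h := (convexOn_rpow_left (b := (16 / 3 : ℝ)) (by norm_num)).2 (Set.mem_univ 0)
    (Set.mem_univ (1 / 2)) (show 0 ≤ 1 - 2 * x by linarith) (show 0 ≤ 2 * x by linarith) (by ring)
  simp only [smul_eq_mul, rpow_zero, ← sqrt_eq_rpow] at h
  rw [show (1 - 2 * x) * 0 + 2 * x * (1 / 2) = x by ring] at h
  have hs : √(16 / 3 : ℝ) ≤ 2.31 := by
    rw [sqrt_le_left (by norm_num)]
    norm_num
  nlinarith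

/-- `s ↦ (2s)^q C^{-s/2}` takes its maximum over `[8/3, ∞)` at `8/3`. -/
lemma two_mul_rpow_mul_rpow_le {q s C : ℝ} (hq0 : 0 ≤ q) (hq : q ≤ 3 / 2) (hs : 8 / 3 ≤ s)
    (hC : 20 ≤ C) :
    (2 * s) ^ q * C ^ (-s / 2) ≤ (16 / 3) ^ q * C ^ (-(4 / 3) : ℝ) := by
  have hC0 : 0 < C := by linarith
  have hlog : 9 / 8 ≤ log C := by
    rw [le_log_iff_exp_le hC0]
    calc exp (9 / 8) ≤ exp (2 : ℕ) := exp_le_exp.2 (by norm_num)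
      _ = exp 1 ^ 2 := by rw [← exp_nat_mul, mul_one]
      _ ≤ 2.7182818286 ^ 2 := pow_le_pow_left₀ (exp_pos 1).le exp_one_lt_d9.le 2
      _ ≤ C := by linarith
  have hls : log (2 * s) ≤ log (16 / 3) + (3 * s / 8 - 1) := by
    have h := log_le_sub_one_of_pos (show 0 < 3 * s / 8 by linarith)
    rw [show 2 * s = 16 / 3 * (3 * s / 8) by ring, log_mul (by norm_num) (by linarith)]
    linarith
  rw [rpow_def_of_pos (by linarith), rpow_def_of_pos hC0, rpow_def_of_pos (by norm_num),
    rpow_def_of_pos hC0, ← exp_add, ← exp_add, exp_le_exp]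
  have h1 := mul_le_mul_of_nonneg_right hls hq0
  nlinarith [mul_nonneg (show 0 ≤ s - 8 / 3 by linarith) (show 0 ≤ log C - 9 / 8 by linarith),
    mul_nonneg (show 0 ≤ s - 8 / 3 by linarith) (show 0 ≤ 3 / 2 - q by linarith)]

lemma rational_bound {x : ℝ} (h0 : 0 ≤ x) (h1 : x < 1 / 2) :
    0.0757 * (1 + 2.62 * x) / (1 - x) ^ 2 <
      x ^ 2 / (1 - 2 * x) + 0.227 * x + (1 + x) * (2 + x) * (20 - 7 * x - x ^ 2) / 512 := by
  have hx2 : 0 < 1 - 2 * x := by linarith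
  have hx1 : 0 < 1 - x := by linarith
  rw [← sub_pos]
  have key : 0 < x ^ 2 * (1 - x) ^ 2 +
      (0.227 * x + (1 + x) * (2 + x) * (20 - 7 * x - x ^ 2) / 512) * ((1 - 2 * x) * (1 - x) ^ 2) -
      0.0757 * (1 + 2.62 * x) * (1 - 2 * x) := by
    have h3 : 0 ≤ x ^ 2 * (1 / 2 - x) := mul_nonneg (sq_nonneg x) (by linarith)
    have h5 : 0 ≤ x ^ 4 * (1 / 2 - x) := mul_nonneg (by positivity) (by linarith)
    nlinarith [sq_nonneg (x - 0.0926), pow_nonneg h0 4, pow_nonneg h0 6, pow_nonneg h0 7]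
  have e : x ^ 2 / (1 - 2 * x) + 0.227 * x + (1 + x) * (2 + x) * (20 - 7 * x - x ^ 2) / 512 -
      0.0757 * (1 + 2.62 * x) / (1 - x) ^ 2 = (x ^ 2 * (1 - x) ^ 2 +
      (0.227 * x + (1 + x) * (2 + x) * (20 - 7 * x - x ^ 2) / 512) * ((1 - 2 * x) * (1 - x) ^ 2) -
      0.0757 * (1 + 2.62 * x) * (1 - 2 * x)) / ((1 - 2 * x) * (1 - x) ^ 2) := by
    have hne : 1 - 2 * x ≠ 0 := hx2.ne'
    generalize 1 - 2 * x = y at hne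
    field_simp
    ring
  rw [e]
  positivity

/-- The ratio of `Ufun` to `s^{-p/2} 2^{3p/2-1} Γ(p/2)`, at `p = 2 + 2x`. -/
lemma Ufun_two_add_eq {x s : ℝ} (h0 : 0 ≤ x) (h1 : x < 1 / 2) (hs : 8 / 3 ≤ s) :
    Ufun (2 + 2 * x) s =
      s ^ (-(2 + 2 * x) / 2) * 2 ^ (3 * (2 + 2 * x) / 2 - 1) * Gamma ((2 + 2 * x) / 2) *
        (2 * ((2 * s) ^ (1 + x) * (2 * π * √15) ^ (-s / 2)) * (1 / Gamma (1 + x)) /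
          (3 * s / 2 - (2 + 2 * x)) + 1 - (1 + x) * (2 + x) / (6 * s) +
          (1 + x) * (2 + x) * (3 + x) * (4 + x) / (72 * s ^ 2)) := by
  have hs0 : 0 < s := by linarith
  have hd : 3 * s / 2 - (2 + 2 * x) ≠ 0 := by linarith
  have hG : 0 < Gamma (1 + x) := Gamma_pos_of_pos (by linarith)
  have e2 : Gamma (1 + x + 2) = (1 + x) * (2 + x) * Gamma (1 + x) := by
    rw [show 1 + x + 2 = 1 + x + 1 + 1 by ring, Gamma_add_one (by linarith),
      Gamma_add_one (by linarith)]
    ring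
  have e4 : Gamma (1 + x + 4) = (1 + x) * (2 + x) * (3 + x) * (4 + x) * Gamma (1 + x) := by
    rw [show 1 + x + 4 = 1 + x + 2 + 1 + 1 by ring, Gamma_add_one (by linarith),
      Gamma_add_one (by linarith), e2]
    ring
  have e3 : (4 : ℝ) ^ (2 + 2 * x) =
      s ^ (-(1 + x)) * 2 ^ (3 * (1 + x) - 1) * (2 * (2 * s) ^ (1 + x)) := by
    rw [mul_rpow (by norm_num) hs0.le, rpow_neg hs0.le, show (4 : ℝ) = 2 ^ (2 : ℝ) by norm_num,
      ← rpow_mul (by norm_num), rpow_sub_one (by norm_num),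
      show (2 : ℝ) * (2 + 2 * x) = 3 * (1 + x) + (1 + x) by ring, rpow_add (by norm_num)]
    have := (rpow_pos_of_pos hs0 (1 + x)).ne'
    field_simp
  rw [Ufun, show (2 + 2 * x) / 2 = 1 + x by ring, show -(2 + 2 * x) / 2 = -(1 + x) by ring,
    show 3 * (2 + 2 * x) / 2 - 1 = 3 * (1 + x) - 1 by ring, e2, e4, e3]
  field_simp
  ring

/-- For all `2 < p < 3` and `s ≥ 8/3`: `U(p,s) < G̃(p,s)`. -/
theorem U_lt_Gtilde (p s : ℝ) (hp2 : 2 < p) (hp3 : p < 3) (hs : 8 / 3 ≤ s) :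
    Ufun p s < Gtilde p s := by
  obtain ⟨x, rfl⟩ : ∃ x, p = 2 + 2 * x := ⟨p / 2 - 1, by ring⟩
  have h0 : 0 ≤ x := by linarith
  have h1 : x < 1 / 2 := by linarith
  have hx1 : 0 < 1 - x := by linarith
  have hs0 : 0 < s := by linarith
  have hd : 0 < 3 * s / 2 - (2 + 2 * x) := by linarith
  have hG : 0 < Gamma ((2 + 2 * x) / 2) := Gamma_pos_of_pos (by linarith)
  rw [Ufun_two_add_eq h0 h1 hs, Gtilde]
  refine mul_lt_mul_of_pos_left ?_ (by positivity)
  refine lt_of_lt_of_le ?_ (Dfun_two_add_lower h0 h1)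
  have hR : (2 * s) ^ (1 + x) * (2 * π * √15) ^ (-s / 2) ≤ 0.0757 * (1 + 2.62 * x) := by
    refine (two_mul_rpow_mul_rpow_le (by linarith) (by linarith) hs
      two_mul_pi_mul_sqrt_fifteen_gt.le).trans ?_
    rw [rpow_add (by norm_num), rpow_one, mul_right_comm]
    exact mul_le_mul mul_rpow_neg_four_thirds_le (sixteen_thirds_rpow_le h0 h1.le)
      (by positivity) (by norm_num)
  have hsd : s / (3 * s / 2 - (2 + 2 * x)) ≤ 4 / (3 * (1 - x)) := by
    rw [div_le_div_iff₀ hd (by positivity)]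
    nlinarith
  set E := 2 * ((2 * s) ^ (1 + x) * (2 * π * √15) ^ (-s / 2)) * (1 / Gamma (1 + x)) /
    (3 * s / 2 - (2 + 2 * x)) with hE
  set B := 0.0757 * (1 + 2.62 * x) / (1 - x) ^ 2 with hB
  have hsE : s * E ≤ 8 / 3 * B := by
    calc s * E = 2 * ((2 * s) ^ (1 + x) * (2 * π * √15) ^ (-s / 2)) * (1 / Gamma (1 + x)) *
          (s / (3 * s / 2 - (2 + 2 * x))) := by rw [hE]; ring
      _ ≤ 2 * (0.0757 * (1 + 2.62 * x)) * (1 / (1 - x)) * (4 / (3 * (1 - x))) := by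
          have hi := inv_Gamma_one_add_le h0 h1
          have hG' : 0 < Gamma (1 + x) := Gamma_pos_of_pos (by linarith)
          gcongr
      _ = 8 / 3 * B := by rw [hB]; field_simp; norm_num
  have hrat := rational_bound h0 h1
  rw [← hB] at hrat
  set W := x ^ 2 / (1 - 2 * x) + 0.227 * x with hW
  have hW0 : 0 ≤ W := by
    have : 0 < 1 - 2 * x := by linarith
    positivity
  have hquad : (1 + x) * (2 + x) * (3 + x) * (4 + x) / (72 * s) ≤
      (1 + x) * (2 + x) * (3 + x) * (4 + x) / 192 := by
    gcongr
    linarith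
  have hmain : s * (E - (1 + x) * (2 + x) / (6 * s) +
      (1 + x) * (2 + x) * (3 + x) * (4 + x) / (72 * s ^ 2)) < s * W := by
    have e : s * (E - (1 + x) * (2 + x) / (6 * s) +
        (1 + x) * (2 + x) * (3 + x) * (4 + x) / (72 * s ^ 2)) = s * E - (1 + x) * (2 + x) / 6 +
        (1 + x) * (2 + x) * (3 + x) * (4 + x) / (72 * s) := by
      field_simp
    have hsW : 8 / 3 * W ≤ s * W := by gcongr
    rw [e]
    linarith
  have := lt_of_mul_lt_mul_left hmain hs0.le
  linarith
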